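/- arXiv:math/0308157 — 2 statements merged into one kernel-verified Lean document; each statement's English description precedes it below -/
import Mathlib

section
/- Let q : ℝ → ℝ be differentiable and suppose that for every a ∈ ℝ the function x ↦ q(x)² is integrable on [a,∞). Define u(s) = ∫_s^∞ q(x)² dx, v(x) = (u(x)² − q(x)²)/2, p(x) = q'(x) + q(x)·u(x), and q₁(x) = x·q(x) − v(x)·q(x) + u(x)·p(x). Assume that for every s ∈ ℝ the functions x ↦ q₁(x)·q(x), x ↦ p(x)², x ↦ x·q(x)², x ↦ q(x)⁴ and x ↦ q'(x)² are integrable on [s,∞). Define u₁(s) = ∫_s^∞ q₁(x)·q(x) dx and w(s) = ∫_s^∞ p(x)² dx. Then for every s ∈ ℝ, 2·u₁(s) − w(s) = ∫_s^∞ (2x·q(x)² + q(x)⁴ − q'(x)²) dx. -/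
open MeasureTheory Filter Set

/-- Evaluation of the combination `2u₁ - w` appearing in the coefficient `c₄` of the
`t⁻⁴` term of the Airy process two-point asymptotic expansion:
`2u₁(s) - w(s) = ∫_s^∞ (2x·q(x)² + q(x)⁴ - q'(x)²) dx`. -/
theorem two_u1_sub_w_eq (q : ℝ → ℝ) (hq : Differentiable ℝ q)
    (hint : ∀ a : ℝ, IntegrableOn (fun x => q x ^ 2) (Ici a))
    (u v p q₁ u₁ w : ℝ → ℝ)
    (hu : ∀ s : ℝ, u s = ∫ x in Ici s, q x ^ 2)
    (hv : ∀ x : ℝ, v x = (u x ^ 2 - q x ^ 2) / 2)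
    (hp : ∀ x : ℝ, p x = deriv q x + q x * u x)
    (hq₁ : ∀ x : ℝ, q₁ x = x * q x - v x * q x + u x * p x)
    (hint₁ : ∀ s : ℝ, IntegrableOn (fun x => q₁ x * q x) (Ici s))
    (hint₂ : ∀ s : ℝ, IntegrableOn (fun x => p x ^ 2) (Ici s))
    (hint₃ : ∀ s : ℝ, IntegrableOn (fun x => x * q x ^ 2) (Ici s))
    (hint₄ : ∀ s : ℝ, IntegrableOn (fun x => q x ^ 4) (Ici s))
    (hint₅ : ∀ s : ℝ, IntegrableOn (fun x => deriv q x ^ 2) (Ici s))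
    (hu₁ : ∀ s : ℝ, u₁ s = ∫ x in Ici s, q₁ x * q x)
    (hw : ∀ s : ℝ, w s = ∫ x in Ici s, p x ^ 2) :
    ∀ s : ℝ, 2 * u₁ s - w s
      = ∫ x in Ici s, (2 * x * q x ^ 2 + q x ^ 4 - deriv q x ^ 2) := by
  intro s
  rw [hu₁, hw, ← integral_const_mul, ← integral_sub ((hint₁ s).const_mul 2) (hint₂ s)]
  congr 1
  funext x
  rw [hq₁, hp, hv]
  ring
end

section
/- Let q : ℝ → ℝ be twice continuously differentiable with q''(x) = x·q(x) + 2·q(x)³ for all x, and suppose q(x) → 0 and q'(x) → 0 as x → +∞, and that for every a ∈ ℝ the functions x ↦ q(x)², x ↦ x·q(x)², x ↦ q(x)⁴ and x ↦ q'(x)² are integrable on [a,∞). Then for every s ∈ ℝ, ∫_s^∞ (2x·q(x)² + q(x)⁴ − q'(x)²) dx = ∫_s^∞ (2(s − x)·q(x)² − q(x)⁴ + q'(x)²) dx. -/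
open MeasureTheory Filter Set

/-- An integrable function on a ray cannot decay exactly like `L / (x - s)` unless `L = 0`. -/
theorem eq_zero_of_tendsto_sub_mul_of_integrableOn {E : ℝ → ℝ} {a s L : ℝ}
    (hE : IntegrableOn E (Ioi a))
    (hL : Tendsto (fun x => (x - s) * E x) atTop (nhds L)) : L = 0 := by
  by_contra hne
  have hpos : 0 < |L| := abs_pos.mpr hne
  obtain ⟨N, hN⟩ := eventually_atTop.mp
    (hL.abs.eventually (lt_mem_nhds (half_lt_self hpos)))
  set M := max (max N a) (max 1 |s|)
  have hNM : N ≤ M := (le_max_left _ _).trans (le_max_left _ _)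
  have haM : a ≤ M := (le_max_right _ _).trans (le_max_left _ _)
  have h1M : 1 ≤ M := (le_max_left _ _).trans (le_max_right _ _)
  have hsM : |s| ≤ M := (le_max_right _ _).trans (le_max_right _ _)
  refine not_integrableOn_Ioi_inv (a := M) ?_
  refine Integrable.mono' (((hE.mono_set (Ioi_subset_Ioi haM)).abs).const_mul (4 / |L|))
    measurable_inv.aestronglyMeasurable ?_
  filter_upwards [ae_restrict_mem measurableSet_Ioi] with x hx
  have hMx : M < x := hx
  have hx0 : 0 < x := by linarith
  have h := hN x (by linarith)
  rw [abs_mul] at h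
  have hxs : |x - s| ≤ 2 * x := by
    rw [abs_le] at hsM ⊢
    constructor <;> linarith
  have hle := mul_le_mul_of_nonneg_right hxs (abs_nonneg (E x))
  rw [Real.norm_of_nonneg (inv_nonneg.mpr hx0.le), inv_le_iff_one_le_mul₀ hx0,
    div_mul_eq_mul_div, div_mul_eq_mul_div, one_le_div hpos]
  linarith

/-- For a Painlevé II solution `q` decaying together with `q'` at `+∞`, the two candidate
formulas for the `c₄` integral agree:
`∫_s^∞ (2x·q² + q⁴ - q'²) dx = ∫_s^∞ (2(s-x)·q² - q⁴ + q'²) dx`. -/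
theorem c4_integrals_agree (q : ℝ → ℝ) (hq : ContDiff ℝ 2 q)
    (hP2 : ∀ x : ℝ, deriv (deriv q) x = x * q x + 2 * q x ^ 3)
    (hq0 : Tendsto q atTop (nhds 0)) (hq'0 : Tendsto (deriv q) atTop (nhds 0))
    (hint1 : ∀ a : ℝ, IntegrableOn (fun x => q x ^ 2) (Ici a))
    (hint2 : ∀ a : ℝ, IntegrableOn (fun x => x * q x ^ 2) (Ici a))
    (hint3 : ∀ a : ℝ, IntegrableOn (fun x => q x ^ 4) (Ici a))
    (hint4 : ∀ a : ℝ, IntegrableOn (fun x => deriv q x ^ 2) (Ici a)) :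
    ∀ s : ℝ,
      (∫ x in Ici s, (2 * x * q x ^ 2 + q x ^ 4 - deriv q x ^ 2))
        = ∫ x in Ici s, (2 * (s - x) * q x ^ 2 - q x ^ 4 + deriv q x ^ 2) := by
  intro s
  have hd : ∀ x, HasDerivAt q (deriv q x) x := fun x =>
    (hq.differentiable (by norm_num) x).hasDerivAt
  have hd' : ∀ x, HasDerivAt (deriv q) (x * q x + 2 * q x ^ 3) x := fun x => by
    rw [← hP2 x]
    exact ((hq.differentiable_deriv_two) x).hasDerivAt
  set E : ℝ → ℝ := fun x => deriv q x ^ 2 - x * q x ^ 2 - q x ^ 4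
  set G : ℝ → ℝ := fun x => deriv q x ^ 2 - q x ^ 4 - 2 * (x * q x ^ 2) + s * q x ^ 2 with hGdef
  have hF : ∀ x, HasDerivAt (fun y => (y - s) * E y) (G x) x := fun x => by
    have h := ((hasDerivAt_id x).sub_const s).mul
      ((((hd' x).pow 2).sub ((hasDerivAt_id x).mul ((hd x).pow 2))).sub ((hd x).pow 4))
    refine HasDerivAt.congr_deriv h ?_
    simp only [hGdef, Pi.pow_apply, Pi.mul_apply, Pi.sub_apply, id]
    norm_num
    ring
  have i1 := (hint1 s).mono_set Ioi_subset_Ici_self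
  have i2 := (hint2 s).mono_set Ioi_subset_Ici_self
  have i3 := (hint3 s).mono_set Ioi_subset_Ici_self
  have i4 := (hint4 s).mono_set Ioi_subset_Ici_self
  have hE : IntegrableOn E (Ioi s) := (i4.sub i2).sub i3
  have hG : IntegrableOn G (Ioi s) := ((i4.sub i3).sub (i2.const_mul 2)).add (i1.const_mul s)
  have hlim := tendsto_limUnder_of_hasDerivAt_of_integrableOn_Ioi (fun x _ => hF x) hG
  rw [eq_zero_of_tendsto_sub_mul_of_integrableOn hE hlim] at hlim
  have hG0 := integral_Ioi_of_hasDerivAt_of_tendsto' (fun x _ => hF x) hG hlim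
  rw [sub_self, zero_mul, sub_zero] at hG0
  rw [integral_Ici_eq_integral_Ioi, integral_Ici_eq_integral_Ioi]
  have hR : IntegrableOn (fun x => 2 * (s - x) * q x ^ 2 - q x ^ 4 + deriv q x ^ 2) (Ioi s) := by
    refine ((((i1.const_mul (2 * s)).sub (i2.const_mul 2)).sub i3).add i4).congr
      (ae_of_all _ fun x => ?_)
    simp only [Pi.add_apply, Pi.sub_apply]
    ring
  calc _ = ∫ x in Ioi s, ((2 * (s - x) * q x ^ 2 - q x ^ 4 + deriv q x ^ 2) - 2 * G x) := by
        congr 1 with x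
        simp only [hGdef]
        ring
    _ = _ := by
        rw [integral_sub hR (hG.const_mul 2), integral_const_mul, hG0, mul_zero, sub_zero]
end
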